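/- arXiv:1410.7506 — 2 statements merged into one kernel-verified Lean document; each statement's English description precedes it below -/
import Mathlib

section
/- For a canonical instance, a valid assignment f is δ-good if and only if for every connected δ-witness (S,T) of w, T is not a subset of f(J_H). -/
open Finset

noncomputable section

open scoped Classical

/-- `wSum w S T = Σ_{h ∈ S, k ∈ T} w h k`. -/
def wSum {M : Type*} (w : M → M → ℝ) (S T : Finset M) : ℝ :=
  ∑ h ∈ S, ∑ k ∈ T, w h k

/-- A canonical instance: pairwise-disjoint machine sets for the heavy jobs, a nonnegative
light-load matrix `w`, and `z : M → [0, 0.4]` with `z i = 0` iff `i` is in no `Mach j`. -/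
def IsCanonical {M JH : Type*} (Mach : JH → Finset M) (w : M → M → ℝ) (z : M → ℝ) : Prop :=
  Pairwise (fun j j' : JH => Disjoint (Mach j) (Mach j')) ∧
  (∀ h k, 0 ≤ w h k) ∧
  (∀ h k, h ≠ k → z k = 0 → w h k = 0) ∧
  (∀ h, 0 < z h → w h h = 0) ∧
  (∀ i, 0 ≤ z i ∧ z i ≤ 0.4) ∧
  (∀ i, z i = 0 ↔ ∀ j, i ∉ Mach j)

/-- A `(p, q, θ)`-canonical instance. -/
def IsPQCanonical {M JH : Type*} [Fintype M] (Mach : JH → Finset M) (w : M → M → ℝ)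
    (z : M → ℝ) (p q θ : ℝ) : Prop :=
  IsCanonical Mach w z ∧
  1 ≤ p ∧ 1 ≤ q ∧ 0 ≤ θ ∧ θ < 0.2 ∧
  (∀ i, z i = 0 ∨ 1 / p ≤ z i) ∧
  (∀ h k, w h k = 0 ∨ 1 / q ≤ w h k) ∧
  (∀ j, 0.2 - θ ≤ ∑ i ∈ Mach j, z i) ∧
  (∀ h, z h + (∑ k, w k h * (1 - z h)) + (∑ k, w h k * z k) ≤ 1 + θ)

/-- A valid assignment of heavy jobs. -/
def IsValid {M JH : Type*} (Mach : JH → Finset M) (f : JH → M) : Prop :=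
  ∀ j, f j ∈ Mach j

/-- `f` is `δ`-good: the light loads can be fractionally assigned (each `w h k` split between
`h` and `k`, with `s h k` placed on `h` and the rest on `k`) so that every machine receives
total load (including 1 for a heavy job, if assigned one) at most `2 - δ`. -/
def IsGood {M JH : Type*} [Fintype M] [DecidableEq M] [Fintype JH]
    (w : M → M → ℝ) (δ : ℝ) (f : JH → M) : Prop :=
  ∃ s : M → M → ℝ,
    (∀ h k, 0 ≤ s h k ∧ s h k ≤ w h k) ∧
    ∀ i : M,
      (if i ∈ Finset.univ.image f then (1 : ℝ) else 0) +
        (∑ k, s i k) + (∑ h, (w h i - s h i)) ≤ 2 - δ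

/-- A `δ`-witness: a pair `(S, T)` with `T ⊆ S` and `|T| + w_{S,S} > (2 - δ)|S|`. -/
def IsWitness {M : Type*} (w : M → M → ℝ) (δ : ℝ) (S T : Finset M) : Prop :=
  T ⊆ S ∧ (2 - δ) * (S.card : ℝ) < (T.card : ℝ) + wSum w S S

/-- The light load graph `G_w` (as an undirected graph capturing weak connectivity):
`h` and `k` are adjacent iff `h ≠ k` and `w h k > 0` or `w k h > 0`. -/
def lightGraph {M : Type*} (w : M → M → ℝ) : SimpleGraph M :=
  SimpleGraph.fromRel (fun h k => 0 < w h k)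

/-- A connected `δ`-witness: a `δ`-witness `(S, T)` such that `S` is weakly connected
in the light load graph `G_w`. -/
def IsConnectedWitness {M : Type*} (w : M → M → ℝ) (δ : ℝ) (S T : Finset M) : Prop :=
  IsWitness w δ S T ∧ (SimpleGraph.induce (↑S : Set M) (lightGraph w)).Connected

/-- The light load on machine `i` when `s h k` of each `w h k` goes to `h` and the rest to `k`. -/
def lightLoad {M : Type*} [Fintype M] (w s : M → M → ℝ) (i : M) : ℝ :=
  ∑ k, s i k + ∑ h, (w h i - s h i)

theorem sum_internal_lightLoad {M : Type*} (w s : M → M → ℝ) (S : Finset M) :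
    ∑ i ∈ S, (∑ k ∈ S, s i k + ∑ h ∈ S, (w h i - s h i)) = wSum w S S := by
  rw [sum_add_distrib, Finset.sum_comm (f := fun i h => w h i - s h i), ← sum_add_distrib, wSum]
  refine sum_congr rfl fun i _ => ?_
  rw [← sum_add_distrib]
  exact sum_congr rfl fun k _ => by ring

theorem wSum_le_sum_lightLoad {M : Type*} [Fintype M] {w s : M → M → ℝ}
    (hs : ∀ h k, 0 ≤ s h k ∧ s h k ≤ w h k) (S : Finset M) :
    wSum w S S ≤ ∑ i ∈ S, lightLoad w s i := by
  rw [← sum_internal_lightLoad w s]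
  refine Finset.sum_le_sum fun i _ => add_le_add ?_ ?_
  · exact sum_le_sum_of_subset_of_nonneg (subset_univ S) fun k _ _ => (hs i k).1
  · exact sum_le_sum_of_subset_of_nonneg (subset_univ S) fun h _ _ => sub_nonneg.2 (hs h i).2

theorem sum_lightLoad_eq_wSum {M : Type*} [Fintype M] {w s : M → M → ℝ} {S : Finset M}
    (hS : ∀ i ∈ S, ∀ k ∉ S, s i k = 0 ∧ s k i = w k i) :
    ∑ i ∈ S, lightLoad w s i = wSum w S S := by
  rw [← sum_internal_lightLoad w s]
  refine sum_congr rfl fun i hi => congrArg₂ (· + ·) ?_ ?_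
  · exact (sum_subset (subset_univ S) fun k _ hk => (hS i hi k hk).1).symm
  · exact (sum_subset (subset_univ S) fun k _ hk => sub_eq_zero.2 (hS i hi k hk).2.symm).symm

/-- Moving `t` units of the load `w h k` from `h` to `k`. -/
theorem lightLoad_shift {M : Type*} [Fintype M] [DecidableEq M] (w s : M → M → ℝ) (h k : M)
    (t : ℝ) (i : M) :
    lightLoad w (fun a b => s a b - if a = h ∧ b = k then t else 0) i =
      lightLoad w s i + t * ((if i = k then 1 else 0) - (if i = h then 1 else 0)) := by
  simp only [lightLoad, sub_sub_eq_add_sub, sum_sub_distrib, sum_add_distrib]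
  have h₁ : ∑ b, (if i = h ∧ b = k then t else 0) = if i = h then t else 0 := by
    by_cases hi : i = h <;> simp [hi]
  have h₂ : ∑ a, (if a = h ∧ i = k then t else 0) = if i = k then t else 0 := by
    by_cases hi : i = k <;> simp [hi]
  rw [h₁, h₂]
  split_ifs <;> ring

theorem sum_sq_shift {M : Type*} [Fintype M] [DecidableEq M] (e : M → ℝ) {h k : M} (hhk : h ≠ k)
    (t : ℝ) :
    ∑ i, (e i + t * ((if i = k then 1 else 0) - (if i = h then 1 else 0))) ^ 2 =
      ∑ i, e i ^ 2 + 2 * t * (t - (e h - e k)) := by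
  have hterm : ∀ i, (e i + t * ((if i = k then 1 else 0) - (if i = h then 1 else 0))) ^ 2 =
      e i ^ 2 + ((if i = k then 2 * t * e i + t ^ 2 else 0) +
        (if i = h then t ^ 2 - 2 * t * e i else 0)) := by
    intro i
    by_cases hk : i = k
    · subst hk
      simp only [if_true, if_neg hhk.symm]
      ring
    · by_cases hh : i = h <;> simp only [if_neg hk, hh, hhk, if_true, if_false] <;> ring
  simp only [hterm, sum_add_distrib, sum_ite_eq', mem_univ, if_true]
  ring

/-- Some splitting of the light loads is balanced relative to the capacities `c`: no load
is placed on the machine with the larger excess. -/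
theorem exists_balanced {M : Type*} [Fintype M] [DecidableEq M] {w : M → M → ℝ}
    (hw : ∀ h k, 0 ≤ w h k) (c : M → ℝ) :
    ∃ s : M → M → ℝ, (∀ h k, 0 ≤ s h k ∧ s h k ≤ w h k) ∧
      ∀ h k,
        (lightLoad w s k - c k < lightLoad w s h - c h → s h k = 0) ∧
        (lightLoad w s h - c h < lightLoad w s k - c k → s h k = w h k) := by
  have hcont : Continuous fun s : M → M → ℝ => ∑ i, (lightLoad w s i - c i) ^ 2 := by
    unfold lightLoad
    fun_prop
  obtain ⟨s, hs, hmin⟩ := (isCompact_Icc (a := (0 : M → M → ℝ)) (b := w)).exists_isMinOn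
    ⟨0, le_rfl, hw⟩ hcont.continuousOn
  have hshift : ∀ h k, h ≠ k → ∀ t, 0 ≤ s h k - t → s h k - t ≤ w h k →
      0 ≤ 2 * t * (t - ((lightLoad w s h - c h) - (lightLoad w s k - c k))) := by
    intro h k hhk t ht₀ ht₁
    have hmem : (fun a b => s a b - if a = h ∧ b = k then t else 0) ∈ Set.Icc 0 w := by
      constructor <;> intro a b <;> by_cases hab : a = h ∧ b = k
      · obtain ⟨rfl, rfl⟩ := hab
        simpa using ht₀
      · simpa [hab] using hs.1 a b
      · obtain ⟨rfl, rfl⟩ := hab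
        simpa using ht₁
      · simpa [hab] using hs.2 a b
    have hle := isMinOn_iff.1 hmin _ hmem
    simp only [lightLoad_shift, add_sub_right_comm] at hle
    rw [sum_sq_shift (fun i => lightLoad w s i - c i) hhk] at hle
    linarith
  refine ⟨s, fun h k => ⟨hs.1 h k, hs.2 h k⟩, fun h k => ⟨fun hlt => ?_, fun hlt => ?_⟩⟩
  · have hhk : h ≠ k := by rintro rfl; exact lt_irrefl _ hlt
    by_contra hne
    have h₀ : 0 < s h k := lt_of_le_of_ne (hs.1 h k) (Ne.symm hne)
    have h₁ : s h k ≤ w h k := hs.2 h k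
    set d := (lightLoad w s h - c h) - (lightLoad w s k - c k) with hd
    have hdpos : 0 < d := sub_pos.2 hlt
    have htpos : 0 < min (s h k) (d / 2) := lt_min h₀ (by linarith)
    have hts := min_le_left (s h k) (d / 2)
    have htd := min_le_right (s h k) (d / 2)
    have := hshift h k hhk (min (s h k) (d / 2)) (by linarith) (by linarith)
    nlinarith
  · have hhk : h ≠ k := by rintro rfl; exact lt_irrefl _ hlt
    by_contra hne
    have h₀ : 0 ≤ s h k := hs.1 h k
    have h₁ : s h k < w h k := lt_of_le_of_ne (hs.2 h k) hne
    set d := (lightLoad w s h - c h) - (lightLoad w s k - c k) with hd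
    have hdneg : d < 0 := sub_neg.2 hlt
    have htpos : 0 < min (w h k - s h k) (-d / 2) := lt_min (sub_pos.2 h₁) (by linarith)
    have hts := min_le_left (w h k - s h k) (-d / 2)
    have htd := min_le_right (w h k - s h k) (-d / 2)
    have := hshift h k hhk (-min (w h k - s h k) (-d / 2)) (by linarith) (by linarith)
    nlinarith

theorem wSum_eq_add_of_no_edges {M : Type*} [DecidableEq M] {w : M → M → ℝ} {A S : Finset M}
    (hAS : A ⊆ S) (hA : ∀ a ∈ A, ∀ b ∈ S \ A, w a b = 0 ∧ w b a = 0) :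
    wSum w S S = wSum w A A + wSum w (S \ A) (S \ A) := by
  simp only [wSum]
  rw [← sum_sdiff hAS, add_comm]
  refine congrArg₂ (· + ·) (sum_congr rfl fun a ha => ?_) (sum_congr rfl fun b hb => ?_)
  · rw [← sum_sdiff hAS, sum_eq_zero fun b hb => (hA a ha b hb).1, zero_add]
  · rw [← sum_sdiff hAS, sum_eq_zero fun a ha => (hA a ha b hb).2, add_zero]

/-- A set whose internal light load exceeds its capacity yields a connected such set. -/
theorem exists_connected_of_sum_lt_wSum {M : Type*} [DecidableEq M] {w : M → M → ℝ}
    (hw : ∀ h k, 0 ≤ w h k) (c : M → ℝ) {S : Finset M} (hS : ∑ i ∈ S, c i < wSum w S S) :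
    ∃ S' : Finset M, ∑ i ∈ S', c i < wSum w S' S' ∧
      (SimpleGraph.induce (↑S' : Set M) (lightGraph w)).Connected := by
  induction S using Finset.strongInduction with
  | H S ih =>
    by_cases hconn : (SimpleGraph.induce (↑S : Set M) (lightGraph w)).Connected
    · exact ⟨S, hS, hconn⟩
    have hne : S.Nonempty := by
      by_contra hemp
      rw [not_nonempty_iff_eq_empty] at hemp
      simp [hemp, wSum] at hS
    have : Nonempty (↑S : Set M) := hne.to_subtype
    have hpre : ¬ (SimpleGraph.induce (↑S : Set M) (lightGraph w)).Preconnected :=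
      fun hp => hconn ⟨hp⟩
    simp only [SimpleGraph.Preconnected, not_forall] at hpre
    obtain ⟨u, v, huv⟩ := hpre
    set A : Finset M := S.filter fun x => ∃ hx : x ∈ (↑S : Set M),
      (SimpleGraph.induce (↑S : Set M) (lightGraph w)).Reachable u ⟨x, hx⟩ with hA
    have hAS : A ⊆ S := filter_subset _ _
    have huA : (u : M) ∈ A := mem_filter.2 ⟨u.2, u.2, SimpleGraph.Reachable.refl _⟩
    have hvA : (v : M) ∉ A := fun hv => huv (mem_filter.1 hv).2.2
    have hnoadj : ∀ a ∈ A, ∀ b ∈ S \ A, ¬ (lightGraph w).Adj a b := by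
      intro a ha b hb hab
      obtain ⟨haS, haS', hua⟩ := mem_filter.1 ha
      obtain ⟨hbS, hbA⟩ := mem_sdiff.1 hb
      refine hbA (mem_filter.2 ⟨hbS, hbS, hua.trans (SimpleGraph.Adj.reachable ?_)⟩)
      exact hab
    have hzero : ∀ a ∈ A, ∀ b ∈ S \ A, w a b = 0 ∧ w b a = 0 := by
      intro a ha b hb
      have hab := hnoadj a ha b hb
      have hne : a ≠ b := fun h => (mem_sdiff.1 hb).2 (h ▸ ha)
      simp only [lightGraph, SimpleGraph.fromRel_adj, not_and, not_or, not_lt] at hab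
      exact ⟨le_antisymm (hab hne).1 (hw a b), le_antisymm (hab hne).2 (hw b a)⟩
    rw [wSum_eq_add_of_no_edges hAS hzero, ← sum_sdiff hAS] at hS
    by_cases hAv : ∑ i ∈ A, c i < wSum w A A
    · exact ih A ⟨hAS, fun hSA => hvA (hSA v.2)⟩ hAv
    · refine ih (S \ A) ⟨sdiff_subset, fun hSA => (mem_sdiff.1 (hSA u.2)).2 huA⟩ ?_
      linarith

/-- For a canonical instance, a valid assignment `f` is δ-good iff for every connected
δ-witness `(S, T)` of `w`, `T` is not a subset of `f(J_H)`. -/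
theorem good_iff_no_connected_witness
    (M JH : Type) [Fintype M] [DecidableEq M] [Fintype JH]
    (Mach : JH → Finset M) (w : M → M → ℝ) (z : M → ℝ) (δ : ℝ) (f : JH → M)
    (hc : IsCanonical Mach w z) (hv : IsValid Mach f) :
    IsGood w δ f ↔
      ∀ S T : Finset M, IsConnectedWitness w δ S T → ¬ T ⊆ Finset.univ.image f := by
  have hw : ∀ h k, 0 ≤ w h k := hc.2.1
  constructor
  · rintro ⟨s, hs, hload⟩ S T ⟨⟨hTS, hwit⟩, -⟩ hT
    have hsum : ∑ i ∈ S, ((if i ∈ univ.image f then (1 : ℝ) else 0) + lightLoad w s i)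
        ≤ ∑ _i ∈ S, (2 - δ) :=
      Finset.sum_le_sum fun i _ => by
        have := hload i
        rw [lightLoad]
        linarith
    rw [sum_add_distrib, sum_const, nsmul_eq_mul] at hsum
    have hcard : (T.card : ℝ) ≤ ∑ i ∈ S, (if i ∈ univ.image f then (1 : ℝ) else 0) := by
      rw [sum_boole]
      exact_mod_cast card_le_card fun x hx => mem_filter.2 ⟨hTS hx, hT hx⟩
    have := wSum_le_sum_lightLoad hs S
    linarith
  · intro hno
    by_contra hbad
    obtain ⟨s, hs, hbal⟩ := exists_balanced hw
      (fun i => 2 - δ - (if i ∈ univ.image f then (1 : ℝ) else 0))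
    set e : M → ℝ := fun i =>
      lightLoad w s i - (2 - δ - (if i ∈ univ.image f then (1 : ℝ) else 0)) with he
    set S : Finset M := univ.filter fun i => 0 < e i with hS
    have hSne : S.Nonempty := by
      by_contra hemp
      refine hbad ⟨s, hs, fun i => ?_⟩
      have hi : i ∉ S := fun hi => hemp ⟨i, hi⟩
      have : e i ≤ 0 := by simpa [hS] using hi
      simp only [he, lightLoad] at this
      linarith
    have heq : ∑ i ∈ S, lightLoad w s i = wSum w S S := by
      refine sum_lightLoad_eq_wSum fun i hi k hk => ?_
      have hi' : 0 < e i := by simpa [hS] using hi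
      have hk' : e k ≤ 0 := by simpa [hS] using hk
      exact ⟨(hbal i k).1 (hk'.trans_lt hi'), (hbal k i).2 (hk'.trans_lt hi')⟩
    have hpos : 0 < ∑ i ∈ S, e i :=
      Finset.sum_pos (fun i hi => by simpa [hS] using hi) hSne
    have hviol : ∑ i ∈ S, (2 - δ - (if i ∈ univ.image f then (1 : ℝ) else 0)) < wSum w S S := by
      simp only [he] at hpos
      rw [sum_sub_distrib, heq] at hpos
      linarith
    obtain ⟨S', hS', hconn⟩ := exists_connected_of_sum_lt_wSum hw _ hviol
    refine hno S' (S'.filter fun i => i ∈ univ.image f)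
      ⟨⟨filter_subset _ _, ?_⟩, hconn⟩ fun x hx => (mem_filter.1 hx).2
    rw [sum_sub_distrib, sum_const, nsmul_eq_mul, sum_boole] at hS'
    linarith
end
end

section
/- There is a constant C large enough so that for every q_0 ≥ 100 and every θ ∈ [0, (log q_0)^{-5}/(4C)), every (q_0, q_0, θ)-canonical instance admits a ((log q_0)^{-5}/C − 4θ)-good assignment. -/
open Finset

noncomputable section

open scoped Classical

/-- Hall-type criterion for orienting fractional loads: if every set `S` of machines has enough
capacity for the loads inside `S`, the loads can be split within the capacities. -/
theorem exists_split_of_wSum_le {M : Type*} [Fintype M] [DecidableEq M] (w : M → M → ℝ)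
    (hw : ∀ h k, 0 ≤ w h k) (c : M → ℝ) (hc : ∀ S : Finset M, wSum w S S ≤ ∑ i ∈ S, c i) :
    ∃ s : M → M → ℝ, (∀ h k, 0 ≤ s h k ∧ s h k ≤ w h k) ∧
      ∀ i, ∑ k, s i k + ∑ h, (w h i - s h i) ≤ c i := by
  let e : (M → M → ℝ) → M → ℝ := fun s i => ∑ k, s i k + ∑ h, (w h i - s h i) - c i
  have hcont : Continuous fun s : M → M → ℝ => ∑ i, (e s i) ^ 2 := by fun_prop
  obtain ⟨s, ⟨hs0, hsw⟩, hmin⟩ := (isCompact_Icc (a := (0 : M → M → ℝ)) (b := w)).exists_isMinOn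
    ⟨0, le_rfl, fun h k => hw h k⟩ hcont.continuousOn
  have hs0' : ∀ a b, 0 ≤ s a b := fun a b => hs0 a b
  have hsw' : ∀ a b, s a b ≤ w a b := fun a b => hsw a b
  have key : ∀ a b r, a ≠ b → 0 ≤ s a b + r → s a b + r ≤ w a b →
      0 ≤ 2 * r * (e s a - e s b) + 2 * r ^ 2 := by
    intro a b r hab h0 h1
    let s' : M → M → ℝ := fun x y => s x y + if x = a then (if y = b then r else 0) else 0
    have hmem : s' ∈ Set.Icc (0 : M → M → ℝ) w := by
      constructor
      · intro x y
        change 0 ≤ s x y + _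
        split_ifs with hx hy
        · subst hx hy; exact h0
        · simpa using hs0' x y
        · simpa using hs0' x y
      · intro x y
        change s x y + _ ≤ w x y
        split_ifs with hx hy
        · subst hx hy; exact h1
        · simpa using hsw' x y
        · simpa using hsw' x y
    have hle : ∑ i, (e s i) ^ 2 ≤ ∑ i, (e s' i) ^ 2 := hmin hmem
    have he' : ∀ i, e s' i = e s i + ((if i = a then r else 0) - (if i = b then r else 0)) := by
      intro i
      have h1 : ∑ k, s' i k = ∑ k, s i k + if i = a then r else 0 := by
        simp only [s', sum_add_distrib]
        split_ifs <;> simp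
      have h2 : ∑ h, (w h i - s' h i) = ∑ h, (w h i - s h i) - if i = b then r else 0 := by
        simp only [s', ← sub_sub, sum_sub_distrib]
        simp
      simp only [e, h1, h2]
      ring
    have hexp : ∑ i, (e s' i) ^ 2 = ∑ i, (e s i) ^ 2 + (2 * r * (e s a - e s b) + 2 * r ^ 2) := by
      have : ∀ i, (e s' i) ^ 2 = (e s i) ^ 2 + ((if i = a then 2 * r * e s i + r ^ 2 else 0) +
          (if i = b then - (2 * r * e s i) + r ^ 2 else 0)) := by
        intro i
        rw [he']
        by_cases hia : i = a
        · have hib : i ≠ b := hia ▸ hab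
          simp only [hia, hab, if_true, if_false]
          ring
        · by_cases hib : i = b
          · simp only [hib, hab.symm, if_true, if_false]
            ring
          · simp [hia, hib]
      simp only [this, sum_add_distrib, sum_ite_eq', mem_univ, if_true]
      ring
    linarith
  have hzero : ∀ a b, e s b < e s a → s a b = 0 := by
    intro a b hab
    by_contra hne
    have hpos : 0 < s a b := lt_of_le_of_ne (hs0' a b) (Ne.symm hne)
    have hab' : a ≠ b := by rintro rfl; exact lt_irrefl _ hab
    have ht : 0 < min (s a b) ((e s a - e s b) / 2) := lt_min hpos (by linarith)
    have h1 := min_le_left (s a b) ((e s a - e s b) / 2)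
    have h2 := min_le_right (s a b) ((e s a - e s b) / 2)
    have := key a b (-min (s a b) ((e s a - e s b) / 2)) hab' (by linarith)
      (by linarith [hsw' a b])
    nlinarith
  have hfull : ∀ a b, e s a < e s b → s a b = w a b := by
    intro a b hab
    by_contra hne
    have hpos : s a b < w a b := lt_of_le_of_ne (hsw' a b) hne
    have hab' : a ≠ b := by rintro rfl; exact lt_irrefl _ hab
    have ht : 0 < min (w a b - s a b) ((e s b - e s a) / 2) :=
      lt_min (by linarith) (by linarith)
    have h1 := min_le_left (w a b - s a b) ((e s b - e s a) / 2)
    have h2 := min_le_right (w a b - s a b) ((e s b - e s a) / 2)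
    have := key a b (min (w a b - s a b) ((e s b - e s a) / 2)) hab' (by linarith [hs0' a b])
      (by linarith)
    nlinarith
  refine ⟨s, fun h k => ⟨hs0' h k, hsw' h k⟩, ?_⟩
  by_contra! hex
  obtain ⟨i₀, hi₀⟩ := hex
  let S : Finset M := univ.filter fun i => 0 < e s i
  have hS : ∀ i, i ∈ S ↔ 0 < e s i := fun i => by simp [S]
  have hi₀S : i₀ ∈ S := (hS i₀).2 (by simp only [e]; linarith)
  have hpos : 0 < ∑ i ∈ S, e s i := sum_pos (fun i hi => (hS i).1 hi) ⟨i₀, hi₀S⟩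
  have hload : ∑ i ∈ S, e s i = wSum w S S - ∑ i ∈ S, c i := by
    have h1 : ∀ i ∈ S, e s i = ∑ k ∈ S, s i k + ∑ h ∈ S, (w h i - s h i) - c i := by
      intro i hi
      have hk : ∑ k ∈ S, s i k = ∑ k, s i k := by
        refine sum_subset (subset_univ _) fun k _ hk => hzero i k ?_
        have h2 := (hS i).1 hi
        have h3 : ¬ 0 < e s k := fun h => hk ((hS k).2 h)
        linarith
      have hh : ∑ h ∈ S, (w h i - s h i) = ∑ h, (w h i - s h i) := by
        refine sum_subset (subset_univ _) fun k _ hk => sub_eq_zero.2 (hfull k i ?_).symm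
        have h2 := (hS i).1 hi
        have h3 : ¬ 0 < e s k := fun h => hk ((hS k).2 h)
        linarith
      rw [hk, hh]
    rw [sum_congr rfl h1, sum_sub_distrib, sum_add_distrib]
    rw [sum_comm (s := S) (t := S) (f := fun i h => w h i - s h i)]
    simp only [sum_sub_distrib, wSum]
    ring
  linarith [hc S]

/-- Total weight of the assignments `f` with `f j ∈ Mach j` satisfying `P`, where `f` has weight
`∏ j, p j (f j)`. -/
def assignmentWeight {M JH : Type*} [Fintype JH] (Mach : JH → Finset M) (p : JH → M → ℝ)
    (P : (JH → M) → Prop) : ℝ :=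
  ∑ f ∈ Fintype.piFinset Mach, if P f then ∏ j, p j (f j) else 0

section LocalLemma

variable {M JH : Type*} [Fintype JH] {Mach : JH → Finset M} {p : JH → M → ℝ}

theorem prod_nonneg_of_mem_piFinset (hp : ∀ j, ∀ i ∈ Mach j, 0 ≤ p j i) {f : JH → M}
    (hf : f ∈ Fintype.piFinset Mach) : 0 ≤ ∏ j, p j (f j) :=
  prod_nonneg fun j _ => hp j _ (Fintype.mem_piFinset.1 hf j)

theorem assignmentWeight_mono (hp : ∀ j, ∀ i ∈ Mach j, 0 ≤ p j i) {P Q : (JH → M) → Prop}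
    (h : ∀ f ∈ Fintype.piFinset Mach, P f → Q f) :
    assignmentWeight Mach p P ≤ assignmentWeight Mach p Q := by
  refine sum_le_sum fun f hf => ?_
  have h0 := prod_nonneg_of_mem_piFinset hp hf
  by_cases hP : P f
  · simp [hP, h f hf hP]
  · rw [if_neg hP]
    split_ifs <;> simp [h0]

theorem assignmentWeight_nonneg (hp : ∀ j, ∀ i ∈ Mach j, 0 ≤ p j i) (P : (JH → M) → Prop) :
    0 ≤ assignmentWeight Mach p P :=
  sum_nonneg fun f hf => by
    have h0 := prod_nonneg_of_mem_piFinset hp hf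
    split_ifs <;> simp [h0]

theorem assignmentWeight_true (hp1 : ∀ j, ∑ i ∈ Mach j, p j i = 1) {P : (JH → M) → Prop}
    (hP : ∀ f, P f) : assignmentWeight Mach p P = 1 := by
  simp only [assignmentWeight, hP, if_true]
  rw [← prod_univ_sum]
  simp [hp1]

/-- Fixing one coordinate is independent of conditions on the other coordinates. -/
theorem assignmentWeight_fix (hp1 : ∀ j, ∑ i ∈ Mach j, p j i = 1) (b : JH) {t : M}
    (ht : t ∈ Mach b) {P : (JH → M) → Prop}
    (hP : ∀ f i, P (Function.update f b i) ↔ P f) :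
    assignmentWeight Mach p (fun f => f b = t ∧ P f) = p b t * assignmentWeight Mach p P := by
  have hprod : ∀ f : JH → M, ∏ j, p j (f j) = p b (f b) * ∏ j ∈ univ.erase b, p j (f j) :=
    fun f => (mul_prod_erase _ _ (mem_univ b)).symm
  have hupd : ∀ (f : JH → M) i, ∏ j ∈ univ.erase b, p j (Function.update f b i j) =
      ∏ j ∈ univ.erase b, p j (f j) := fun f i =>
    prod_congr rfl fun j hj => by rw [Function.update_of_ne (ne_of_mem_erase hj)]
  have hswap : ∑ x ∈ (Fintype.piFinset Mach).filter (fun f => f b = t) ×ˢ Mach b,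
        (if P x.1 then p b t * (p b x.2 * ∏ j ∈ univ.erase b, p j (x.1 j)) else 0) =
      ∑ f ∈ Fintype.piFinset Mach,
        (if P f then p b t * (p b (f b) * ∏ j ∈ univ.erase b, p j (f j)) else 0) := by
    refine sum_nbij' (fun x => Function.update x.1 b x.2)
      (fun f => (Function.update f b t, f b)) ?_ ?_ ?_ ?_ ?_
    · rintro ⟨f, i⟩ hx
      simp only [mem_product, mem_filter, Fintype.mem_piFinset] at hx ⊢
      intro j
      by_cases hj : j = b
      · subst hj; simpa using hx.2
      · simpa [hj] using hx.1.1 j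
    · intro f hf
      simp only [mem_product, mem_filter, Fintype.mem_piFinset] at hf ⊢
      refine ⟨⟨fun j => ?_, by simp⟩, hf b⟩
      by_cases hj : j = b
      · subst hj; simpa using ht
      · simpa [hj] using hf j
    · rintro ⟨f, i⟩ hx
      simp only [mem_product, mem_filter] at hx
      simp [← hx.1.2]
    · intro f _
      simp
    · rintro ⟨f, i⟩ hx
      simp only [hP, hupd, Function.update_self]
  rw [sum_product] at hswap
  simp only [assignmentWeight, mul_sum]
  calc _ = ∑ f ∈ (Fintype.piFinset Mach).filter (fun f => f b = t),
        if P f then ∏ j, p j (f j) else 0 := by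
        rw [sum_filter]
        exact sum_congr rfl fun f _ => by split_ifs <;> simp_all
    _ = ∑ f ∈ (Fintype.piFinset Mach).filter (fun f => f b = t), ∑ i ∈ Mach b,
        (if P f then p b t * (p b i * ∏ j ∈ univ.erase b, p j (f j)) else 0) := by
        refine sum_congr rfl fun f hf => ?_
        split_ifs with h
        · rw [← mul_sum, ← sum_mul, hp1, one_mul, hprod, (mem_filter.1 hf).2]
        · simp
    _ = _ := by
        rw [hswap]
        exact sum_congr rfl fun f _ => by rw [hprod f]; split_ifs <;> simp

theorem assignmentWeight_fix_finset (hp1 : ∀ j, ∑ i ∈ Mach j, p j i = 1) (B : Finset JH)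
    {g : JH → M} (hg : ∀ b ∈ B, g b ∈ Mach b) {P : (JH → M) → Prop}
    (hP : ∀ b ∈ B, ∀ f i, P (Function.update f b i) ↔ P f) :
    assignmentWeight Mach p (fun f => (∀ b ∈ B, f b = g b) ∧ P f) =
      (∏ b ∈ B, p b (g b)) * assignmentWeight Mach p P := by
  induction B using Finset.induction_on with
  | empty => simp
  | insert b B hb ih =>
    have h1 : (fun f : JH → M => (∀ b' ∈ insert b B, f b' = g b') ∧ P f) =
        fun f => f b = g b ∧ ((∀ b' ∈ B, f b' = g b') ∧ P f) := by
      funext f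
      simp [and_assoc]
    rw [h1, assignmentWeight_fix hp1 b (hg b (mem_insert_self _ _)), prod_insert hb, mul_assoc,
      ih (fun b' h => hg b' (mem_insert_of_mem h)) fun b' h => hP b' (mem_insert_of_mem h)]
    intro f i
    rw [hP b (mem_insert_self _ _)]
    refine and_congr_left fun _ => forall₂_congr fun b' hb' => ?_
    rw [Function.update_of_ne (ne_of_mem_of_not_mem hb' hb)]

variable [DecidableEq M]

/-- `f` covers no bad set using only the jobs in `A`. -/
def AvoidsOn (𝒯 : Finset (Finset M)) (A : Finset JH) (f : JH → M) : Prop :=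
  ∀ T ∈ 𝒯, ¬ T ⊆ A.image f

/-- A weighted local lemma, proved by counting: adding one job keeps at least half of the weight
of the assignments avoiding all bad sets. -/
theorem assignmentWeight_avoidsOn_insert (hd : Pairwise fun j j' => Disjoint (Mach j) (Mach j'))
    (hp : ∀ j, ∀ i ∈ Mach j, 0 ≤ p j i) (hp1 : ∀ j, ∑ i ∈ Mach j, p j i = 1) {y : M → ℝ}
    (hy0 : ∀ i, 0 ≤ y i) (hy : ∀ j, ∀ i ∈ Mach j, 2 * p j i ≤ y i) {𝒯 : Finset (Finset M)}
    (h𝒯 : ∀ i, ∑ T ∈ 𝒯, (if i ∈ T then ∏ k ∈ T.erase i, y k else 0) ≤ 1 / 2)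
    (A : Finset JH) {j : JH} (hj : j ∉ A) :
    assignmentWeight Mach p (AvoidsOn 𝒯 A) ≤
      2 * assignmentWeight Mach p (AvoidsOn 𝒯 (insert j A)) := by
  induction hn : A.card using Nat.strong_induction_on generalizing A j with
  | _ n ih =>
  subst hn
  set N : Finset JH → ℝ := fun A => assignmentWeight Mach p (AvoidsOn 𝒯 A) with hN
  have hN0 : ∀ A, 0 ≤ N A := fun A => assignmentWeight_nonneg hp _
  have hgrow : ∀ B D : Finset JH, B ⊆ A → D ⊆ A → Disjoint B D →
      N D ≤ 2 ^ B.card * N (D ∪ B) := by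
    intro B
    induction B using Finset.induction_on with
    | empty => intro D _ _ _; simp
    | insert b B hb ihB =>
      intro D hBA hD hdisj
      rw [disjoint_insert_left] at hdisj
      obtain ⟨hbA, hBA⟩ := insert_subset_iff.1 hBA
      have h1 := ihB D hBA hD hdisj.2
      have hbn : b ∉ D ∪ B := by simp [hb, hdisj.1]
      have hcard : (D ∪ B).card < A.card :=
        card_lt_card ((ssubset_iff_of_subset (union_subset hD hBA)).2 ⟨b, hbA, hbn⟩)
      have h2 : N (D ∪ B) ≤ 2 * N (insert b (D ∪ B)) := ih _ hcard (D ∪ B) hbn rfl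
      rw [card_insert_of_notMem hb, union_insert, pow_succ, mul_assoc]
      exact h1.trans (mul_le_mul_of_nonneg_left h2 (by positivity))
  have hinj : ∀ {a b : JH} {t : M}, t ∈ Mach a → t ∈ Mach b → a = b := by
    intro a b t ha hb
    by_contra hab
    exact disjoint_left.1 (hd hab) ha hb
  have hbad : ∀ T ∈ 𝒯, assignmentWeight Mach p
      (fun f => AvoidsOn 𝒯 A f ∧ T ⊆ (insert j A).image f ∧ f j ∈ T) ≤
      ∑ i ∈ Mach j, (if i ∈ T then p j i * ∏ k ∈ T.erase i, y k else 0) * N A := by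
    intro T hT
    have hterm : ∀ i ∈ Mach j,
        0 ≤ (if i ∈ T then p j i * ∏ k ∈ T.erase i, y k else 0) * N A := fun i hi => by
      refine mul_nonneg ?_ (hN0 A)
      split_ifs
      · exact mul_nonneg (hp j i hi) (prod_nonneg fun k _ => hy0 k)
      · exact le_rfl
    by_cases hex : ∃ g ∈ Fintype.piFinset Mach, T ⊆ (insert j A).image g ∧ g j ∈ T
    · obtain ⟨g, hg, hTg, hgj⟩ := hex
      rw [Fintype.mem_piFinset] at hg
      have hginj : Function.Injective g := fun a b hab => hinj (hg a) (hab ▸ hg b)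
      let B : Finset JH := A.filter fun b => g b ∈ T
      have hjB : j ∉ B := fun h => hj (mem_filter.1 h).1
      have himg : (insert j B).image g = T := by
        ext t
        constructor
        · intro ht
          obtain ⟨b, hb, rfl⟩ := mem_image.1 ht
          rcases mem_insert.1 hb with rfl | hb
          · exact hgj
          · exact (mem_filter.1 hb).2
        · intro ht
          obtain ⟨b, hb, rfl⟩ := mem_image.1 (hTg ht)
          refine mem_image_of_mem _ ?_
          rcases mem_insert.1 hb with rfl | hb
          · exact mem_insert_self _ _
          · exact mem_insert_of_mem (mem_filter.2 ⟨hb, ht⟩)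
      have hTerase : T.erase (g j) = B.image g := by
        rw [← himg, image_insert, erase_insert]
        intro h
        obtain ⟨b, hb, hbj⟩ := mem_image.1 h
        exact hjB (hginj hbj ▸ hb)
      have h1 : assignmentWeight Mach p
          (fun f => AvoidsOn 𝒯 A f ∧ T ⊆ (insert j A).image f ∧ f j ∈ T) ≤
          assignmentWeight Mach p
          (fun f => (∀ b ∈ insert j B, f b = g b) ∧ AvoidsOn 𝒯 (A \ B) f) := by
        refine assignmentWeight_mono hp fun f hf ⟨hA, hTf, _⟩ => ⟨fun b hb => ?_, ?_⟩
        · rw [Fintype.mem_piFinset] at hf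
          have : g b ∈ T := himg ▸ mem_image_of_mem g hb
          obtain ⟨b', _, hb'⟩ := mem_image.1 (hTf this)
          have hbb : b' = b := hinj (hf b') (hb' ▸ hg b)
          rw [← hb', hbb]
        · exact fun T' hT' h => hA T' hT' (h.trans (image_subset_image sdiff_subset))
      have h2 := assignmentWeight_fix_finset (p := p) hp1 (insert j B) (g := g)
        (fun b _ => hg b) (P := AvoidsOn 𝒯 (A \ B)) (by
          intro b hb f i
          have : (A \ B).image (Function.update f b i) = (A \ B).image f := by
            refine image_congr fun a ha => Function.update_of_ne ?_ _ _
            rintro rfl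
            rcases mem_insert.1 hb with rfl | hb
            · exact hj (mem_sdiff.1 ha).1
            · exact (mem_sdiff.1 ha).2 hb
          simp only [AvoidsOn, this])
      have h3 := hgrow B (A \ B) (filter_subset _ _) sdiff_subset disjoint_sdiff
      rw [sdiff_union_of_subset (filter_subset _ _)] at h3
      have hBnn : 0 ≤ ∏ b ∈ B, p b (g b) := prod_nonneg fun b _ => hp b _ (hg b)
      calc _ ≤ (∏ b ∈ insert j B, p b (g b)) * N (A \ B) := h1.trans h2.le
        _ = p j (g j) * ((∏ b ∈ B, p b (g b)) * N (A \ B)) := by rw [prod_insert hjB]; ring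
        _ ≤ p j (g j) * ((∏ b ∈ B, p b (g b)) * (2 ^ B.card * N A)) :=
            mul_le_mul_of_nonneg_left (mul_le_mul_of_nonneg_left h3 hBnn) (hp j _ (hg j))
        _ = p j (g j) * (∏ b ∈ B, 2 * p b (g b)) * N A := by
            rw [prod_mul_distrib, prod_const]; ring
        _ ≤ p j (g j) * (∏ b ∈ B, y (g b)) * N A := by
            refine mul_le_mul_of_nonneg_right (mul_le_mul_of_nonneg_left ?_ (hp j _ (hg j)))
              (hN0 A)
            exact prod_le_prod (fun b _ => mul_nonneg two_pos.le (hp b _ (hg b)))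
              fun b _ => hy b _ (hg b)
        _ = (if g j ∈ T then p j (g j) * ∏ k ∈ T.erase (g j), y k else 0) * N A := by
            rw [if_pos hgj, hTerase, prod_image hginj.injOn]
        _ ≤ _ := single_le_sum hterm (hg j)
    · refine le_trans (le_of_eq ?_) (sum_nonneg hterm)
      refine sum_eq_zero fun f hf => if_neg ?_
      rintro ⟨_, h1, h2⟩
      exact hex ⟨f, hf, h1, h2⟩
  have hsplit : N A ≤ N (insert j A) + ∑ T ∈ 𝒯, assignmentWeight Mach p
      (fun f => AvoidsOn 𝒯 A f ∧ T ⊆ (insert j A).image f ∧ f j ∈ T) := by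
    simp only [hN, assignmentWeight]
    rw [sum_comm, ← sum_add_distrib]
    refine sum_le_sum fun f hf => ?_
    have h0 := prod_nonneg_of_mem_piFinset hp hf
    have hnn : ∀ T ∈ 𝒯, 0 ≤ @ite ℝ
        (AvoidsOn 𝒯 A f ∧ T ⊆ (insert j A).image f ∧ f j ∈ T) (Classical.propDecidable _)
        (∏ j, p j (f j)) 0 := fun T _ => by split_ifs <;> simp [h0]
    by_cases hA : AvoidsOn 𝒯 A f
    · by_cases hA' : AvoidsOn 𝒯 (insert j A) f
      · rw [if_pos hA, if_pos hA']
        linarith [sum_nonneg hnn]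
      · obtain ⟨T, hT, hTf⟩ : ∃ T ∈ 𝒯, T ⊆ (insert j A).image f := by
          simpa [AvoidsOn] using hA'
        have hfj : f j ∈ T := by
          by_contra hfj
          refine hA T hT fun t ht => ?_
          have := hTf ht
          rw [image_insert, mem_insert] at this
          exact this.resolve_left fun h => hfj (h ▸ ht)
        have := single_le_sum hnn hT
        rw [if_pos ⟨hA, hTf, hfj⟩] at this
        rw [if_pos hA, if_neg hA']
        linarith
    · rw [if_neg hA]
      refine add_nonneg ?_ (sum_nonneg hnn)
      split_ifs <;> simp [h0]
  have htotal : ∑ T ∈ 𝒯, ∑ i ∈ Mach j,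
      (if i ∈ T then p j i * ∏ k ∈ T.erase i, y k else 0) * N A ≤ 1 / 2 * N A := by
    rw [sum_comm]
    calc _ = (∑ i ∈ Mach j, p j i *
          ∑ T ∈ 𝒯, (if i ∈ T then ∏ k ∈ T.erase i, y k else 0)) * N A := by
          rw [sum_mul]
          refine sum_congr rfl fun i _ => ?_
          rw [← sum_mul, mul_sum]
          simp only [mul_ite, mul_zero]
      _ ≤ (∑ i ∈ Mach j, p j i * (1 / 2)) * N A :=
          mul_le_mul_of_nonneg_right
            (sum_le_sum fun i hi => mul_le_mul_of_nonneg_left (h𝒯 i) (hp j i hi)) (hN0 A)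
      _ = _ := by rw [← sum_mul, hp1, one_mul]
  have := hsplit.trans (add_le_add_right ((sum_le_sum hbad).trans htotal) _)
  change N A ≤ 2 * N (insert j A)
  linarith

/-- The weighted local lemma for disjoint choice sets: if around every machine the bad sets have
small total weight, some assignment covers no bad set. -/
theorem exists_assignment_avoiding (hd : Pairwise fun j j' => Disjoint (Mach j) (Mach j'))
    (hp : ∀ j, ∀ i ∈ Mach j, 0 ≤ p j i) (hp1 : ∀ j, ∑ i ∈ Mach j, p j i = 1) {y : M → ℝ}
    (hy0 : ∀ i, 0 ≤ y i) (hy : ∀ j, ∀ i ∈ Mach j, 2 * p j i ≤ y i) {𝒯 : Finset (Finset M)}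
    (hne : ∅ ∉ 𝒯)
    (h𝒯 : ∀ i, ∑ T ∈ 𝒯, (if i ∈ T then ∏ k ∈ T.erase i, y k else 0) ≤ 1 / 2) :
    ∃ f : JH → M, (∀ j, f j ∈ Mach j) ∧ ∀ T ∈ 𝒯, ¬ T ⊆ univ.image f := by
  have hpos : ∀ A : Finset JH, 0 < assignmentWeight Mach p (AvoidsOn 𝒯 A) := by
    intro A
    induction A using Finset.induction_on with
    | empty =>
      rw [assignmentWeight_true hp1]
      · exact one_pos
      · intro f T hT h
        rw [image_empty, subset_empty] at h
        exact hne (h ▸ hT)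
    | insert j A hj ih =>
      linarith [assignmentWeight_avoidsOn_insert hd hp hp1 hy0 hy h𝒯 A hj]
  by_contra! hcon
  refine (hpos univ).ne' (sum_eq_zero fun f hf => if_neg fun h => ?_)
  obtain ⟨T, hT, hTf⟩ := hcon f (Fintype.mem_piFinset.1 hf)
  exact h T hT hTf

end LocalLemma

section SubsetSums

variable {M : Type*} {y : M → ℝ}

theorem sum_powersetCard_prod_le (hy : ∀ i, 0 ≤ y i) (s : Finset M) (m n : ℕ) {x : ℝ}
    (hx : 0 < x) (hs : x * ∑ i ∈ s, y i ≤ n) :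
    ∑ T ∈ powersetCard m s, ∏ k ∈ T, y k ≤ 3 ^ n / x ^ m := by
  rw [le_div_iff₀ (by positivity), sum_mul]
  calc ∑ T ∈ powersetCard m s, (∏ k ∈ T, y k) * x ^ m
      = ∑ T ∈ powersetCard m s, ∏ k ∈ T, x * y k := by
        refine sum_congr rfl fun T hT => ?_
        rw [prod_mul_distrib, prod_const, (mem_powersetCard.1 hT).2, mul_comm]
    _ ≤ ∑ T ∈ s.powerset, ∏ k ∈ T, x * y k := by
        refine sum_le_sum_of_subset_of_nonneg
          (fun T hT => mem_powerset.2 (mem_powersetCard.1 hT).1) fun T _ _ =>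
          prod_nonneg fun k _ => mul_nonneg hx.le (hy k)
    _ = ∏ k ∈ s, (1 + x * y k) := (prod_one_add s).symm
    _ ≤ ∏ k ∈ s, Real.exp (x * y k) :=
        prod_le_prod (fun k _ => by have := mul_nonneg hx.le (hy k); linarith)
          fun k _ => by rw [add_comm]; exact Real.add_one_le_exp _
    _ = Real.exp (x * ∑ k ∈ s, y k) := by rw [← Real.exp_sum, mul_sum]
    _ ≤ Real.exp n := Real.exp_le_exp.2 hs
    _ = Real.exp 1 ^ n := by rw [← Real.exp_nat_mul, mul_one]
    _ ≤ 3 ^ n := pow_le_pow_left₀ (Real.exp_pos 1).le Real.exp_one_lt_three.le n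

theorem sum_biUnion_le_sum {ι κ : Type*} [DecidableEq κ] (s : Finset ι) (t : ι → Finset κ)
    {g : κ → ℝ} (hg : ∀ x, 0 ≤ g x) :
    ∑ x ∈ s.biUnion t, g x ≤ ∑ i ∈ s, ∑ x ∈ t i, g x := by
  induction s using Finset.induction_on with
  | empty => simp
  | insert i s hi ih =>
    rw [biUnion_insert, sum_insert hi]
    have h1 := sum_union_inter (s₁ := t i) (s₂ := s.biUnion t) (f := g)
    have h2 : 0 ≤ ∑ x ∈ t i ∩ s.biUnion t, g x := sum_nonneg fun x _ => hg x
    linarith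

variable [DecidableEq M]

/-- The weight of a set with the point `i` removed, counted only if the set contains `i`. -/
def linkWeight (y : M → ℝ) (i : M) (T : Finset M) : ℝ :=
  if i ∈ T then ∏ k ∈ T.erase i, y k else 0

theorem linkWeight_nonneg (hy : ∀ i, 0 ≤ y i) (i : M) (T : Finset M) : 0 ≤ linkWeight y i T := by
  unfold linkWeight
  split_ifs
  · exact prod_nonneg fun k _ => hy k
  · exact le_rfl

theorem linkWeight_insert_self {i : M} {T : Finset M} (hi : i ∉ T) :
    linkWeight y i (insert i T) = ∏ k ∈ T, y k := by
  rw [linkWeight, if_pos (mem_insert_self i T), erase_insert hi]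

theorem linkWeight_insert_of_ne {i v : M} {T : Finset M} (hv : v ∉ T) (hiv : i ≠ v) :
    linkWeight y i (insert v T) = y v * linkWeight y i T := by
  unfold linkWeight
  by_cases hi : i ∈ T
  · rw [if_pos hi, if_pos (mem_insert_of_mem hi), erase_insert_of_ne hiv.symm, prod_insert]
    exact fun h => hv (mem_of_mem_erase h)
  · rw [if_neg hi, if_neg (by simp [hi, hiv]), mul_zero]

theorem sum_linkWeight_powersetCard_le (hy : ∀ i, 0 ≤ y i) (s : Finset M) (m : ℕ) (i : M) :
    ∑ T ∈ powersetCard (m + 1) s, linkWeight y i T ≤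
      if i ∈ s then ∑ T ∈ powersetCard m s, ∏ k ∈ T, y k else 0 := by
  simp only [linkWeight]
  rw [← sum_filter]
  split_ifs with hi
  · rw [← sum_image (f := fun T => ∏ k ∈ T, y k) (g := fun T => T.erase i)
      (s := (powersetCard (m + 1) s).filter fun T => i ∈ T)]
    · refine sum_le_sum_of_subset_of_nonneg (fun T hT => ?_) fun T _ _ =>
        prod_nonneg fun k _ => hy k
      obtain ⟨T', hT', rfl⟩ := mem_image.1 hT
      obtain ⟨h1, h2⟩ := mem_filter.1 hT'
      rw [mem_powersetCard] at h1 ⊢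
      exact ⟨(erase_subset _ _).trans h1.1, by rw [card_erase_of_mem h2, h1.2]; rfl⟩
    · intro T hT T' hT' h
      have h : T.erase i = T'.erase i := h
      rw [← insert_erase (mem_filter.1 hT).2, h, insert_erase (mem_filter.1 hT').2]
  · refine (sum_eq_zero fun T hT => ?_).le
    obtain ⟨h1, h2⟩ := mem_filter.1 hT
    exact absurd ((mem_powersetCard.1 h1).1 h2) hi

end SubsetSums

theorem sum_le_of_card_threshold_le {M : Type*} (s : Finset M) {u : M → ℝ} {N : ℕ} {c : ℝ}
    (hu : ∀ k, u k = 0 ∨ ∃ a < N, 1 / 2 ^ a ≤ u k ∧ u k ≤ 2 / 2 ^ a)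
    (hc : ∀ a < N, ((s.filter fun k => 1 / 2 ^ a ≤ u k).card : ℝ) ≤ c * 2 ^ a) :
    ∑ k ∈ s, u k ≤ 2 * N * c := by
  have h1 : ∀ k, u k ≤ ∑ a ∈ range N, if 1 / 2 ^ a ≤ u k then (2 : ℝ) / 2 ^ a else 0 := by
    intro k
    have hnn : ∀ a ∈ range N, 0 ≤ if 1 / 2 ^ a ≤ u k then (2 : ℝ) / 2 ^ a else 0 := by
      intro a _
      split_ifs
      · positivity
      · exact le_rfl
    rcases hu k with h0 | ⟨a, ha, hlo, hhi⟩
    · rw [h0] at hnn ⊢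
      exact sum_nonneg hnn
    · have := single_le_sum hnn (mem_range.2 ha)
      rw [if_pos hlo] at this
      exact hhi.trans this
  calc ∑ k ∈ s, u k
      ≤ ∑ k ∈ s, ∑ a ∈ range N, if 1 / 2 ^ a ≤ u k then (2 : ℝ) / 2 ^ a else 0 :=
        sum_le_sum fun k _ => h1 k
    _ = ∑ a ∈ range N, ((s.filter fun k => 1 / 2 ^ a ≤ u k).card : ℝ) * (2 / 2 ^ a) := by
        rw [sum_comm]
        refine sum_congr rfl fun a _ => ?_
        rw [← sum_filter, sum_const, nsmul_eq_mul]
    _ ≤ ∑ a ∈ range N, c * 2 ^ a * (2 / 2 ^ a) :=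
        sum_le_sum fun a ha =>
          mul_le_mul_of_nonneg_right (hc a (mem_range.1 ha)) (by positivity)
    _ = ∑ a ∈ range N, 2 * c := sum_congr rfl fun a _ => by field_simp
    _ = 2 * N * c := by rw [sum_const, card_range, nsmul_eq_mul]; ring

section Stars

variable {M : Type*} [DecidableEq M] (w : M → M → ℝ) (V : Finset M)

/-- The vertices of `V` receiving weight at least `2⁻ᵃ` from `h`. -/
def outNbrs (a : ℕ) (h : M) : Finset M := V.filter fun k => 1 / 2 ^ a ≤ w h k

/-- The vertices of `V` sending weight at least `2⁻ᵃ` to `v`. -/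
def inNbrs (a : ℕ) (v : M) : Finset M := V.filter fun h => 1 / 2 ^ a ≤ w h v

/-- Large sets of out-neighbours of one machine. -/
def outStars [Fintype M] (N : ℕ) : Finset (Finset M) :=
  univ.biUnion fun h => (range N).biUnion fun a =>
    powersetCard (80 * N * 2 ^ a + 1) (outNbrs w V a h)

/-- Machines of `V` together with a large set of in-neighbours. -/
def inStars (N : ℕ) : Finset (Finset M) :=
  V.biUnion fun v => (range N).biUnion fun a =>
    (powersetCard (2 ^ a / (8 * N) + 1) (inNbrs w V a v)).image (insert v)

variable {w V} {y : M → ℝ} {N : ℕ}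

theorem sum_linkWeight_outStars_le [Fintype M] (hN : 1 ≤ N) (hw : ∀ h k, 0 ≤ w h k)
    (hy : ∀ i, 0 ≤ y i) (hin : ∀ k, ∑ h, w h k ≤ 2) (hout : ∀ h, ∑ k, w h k * y k ≤ 24) (i : M) :
    ∑ T ∈ outStars w V N, linkWeight y i T ≤ 1 / 4 := by
  have hN' : (1 : ℝ) ≤ N := by exact_mod_cast hN
  have hinner : ∀ (h : M) (a : ℕ),
      ∑ T ∈ powersetCard (80 * N * 2 ^ a + 1) (outNbrs w V a h), linkWeight y i T ≤
        w h i * (1 / (8 * N)) := by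
    intro h a
    refine (sum_linkWeight_powersetCard_le hy _ _ i).trans ?_
    split_ifs with hi
    · have hwi : 1 / 2 ^ a ≤ w h i := (mem_filter.1 hi).2
      have hsum : ∑ k ∈ outNbrs w V a h, y k ≤ 24 * 2 ^ a := by
        have h1 : ∑ k ∈ outNbrs w V a h, y k ≤ ∑ k ∈ outNbrs w V a h, 2 ^ a * (w h k * y k) := by
          refine sum_le_sum fun k hk => ?_
          have h2 : 1 / 2 ^ a ≤ w h k := (mem_filter.1 hk).2
          rw [div_le_iff₀ (by positivity)] at h2
          nlinarith [hy k]
        have h2 : ∑ k ∈ outNbrs w V a h, 2 ^ a * (w h k * y k) ≤ ∑ k, 2 ^ a * (w h k * y k) :=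
          sum_le_sum_of_subset_of_nonneg (subset_univ _) fun k _ _ =>
            mul_nonneg (by positivity) (mul_nonneg (hw h k) (hy k))
        rw [← mul_sum univ] at h2
        have h3 : (2 : ℝ) ^ a * ∑ k, w h k * y k ≤ 2 ^ a * 24 :=
          mul_le_mul_of_nonneg_left (hout h) (by positivity)
        linarith
      have h1 := sum_powersetCard_prod_le hy (outNbrs w V a h) (80 * N * 2 ^ a) (72 * 2 ^ a)
        (x := 3) (by norm_num) (by push_cast; linarith)
      have h2 : (3 : ℝ) ^ (72 * 2 ^ a) / 3 ^ (80 * N * 2 ^ a) ≤ 1 / 3 ^ (8 * N * 2 ^ a) := by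
        rw [div_le_div_iff₀ (by positivity) (by positivity), ← pow_add, one_mul]
        refine pow_le_pow_right₀ (by norm_num) ?_
        nlinarith [Nat.one_le_two_pow (n := a)]
      have h3 : (8 * N * 2 ^ a : ℝ) ≤ 3 ^ (8 * N * 2 ^ a) := by
        have : 8 * N * 2 ^ a < 3 ^ (8 * N * 2 ^ a) := Nat.lt_pow_self (by norm_num)
        exact_mod_cast this.le
      have h4 : 1 / (3 : ℝ) ^ (8 * N * 2 ^ a) ≤ 1 / (8 * N * 2 ^ a) :=
        one_div_le_one_div_of_le (by positivity) h3
      calc _ ≤ 1 / (8 * N * 2 ^ a : ℝ) := h1.trans (h2.trans h4)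
        _ = 1 / 2 ^ a * (1 / (8 * N)) := by field_simp
        _ ≤ _ := mul_le_mul_of_nonneg_right hwi (by positivity)
    · exact mul_nonneg (hw h i) (by positivity)
  calc _ ≤ ∑ h : M, ∑ a ∈ range N,
        ∑ T ∈ powersetCard (80 * N * 2 ^ a + 1) (outNbrs w V a h), linkWeight y i T :=
        (sum_biUnion_le_sum _ _ (linkWeight_nonneg hy i)).trans
          (sum_le_sum fun h _ => sum_biUnion_le_sum _ _ (linkWeight_nonneg hy i))
    _ ≤ ∑ h : M, ∑ a ∈ range N, w h i * (1 / (8 * N)) :=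
        sum_le_sum fun h _ => sum_le_sum fun a _ => hinner h a
    _ = (∑ h : M, w h i) / 8 := by
        simp only [sum_const, card_range, nsmul_eq_mul, sum_div]
        exact sum_congr rfl fun h _ => by field_simp
    _ ≤ 1 / 4 := by linarith [hin i]

theorem sum_linkWeight_inStars_le [Fintype M] (hN : 1 ≤ N) (hw : ∀ h k, 0 ≤ w h k)
    (hy : ∀ i, 0 ≤ y i) (hin : ∀ k, ∑ h, w h k ≤ 2) {τ : ℝ} (hτ0 : 0 < τ)
    (hτ : 800 * N ^ 2 * τ ≤ 1) (hout : ∀ h ∈ V, ∑ k, w h k * y k ≤ τ)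
    (hyV : ∀ h ∈ V, y h ≤ τ) (hdiag : ∀ h ∈ V, w h h = 0) (i : M) :
    ∑ T ∈ inStars w V N, linkWeight y i T ≤ 1 / 4 := by
  have hN' : (1 : ℝ) ≤ N := by exact_mod_cast hN
  set r : ℝ := 48 * N * τ with hr
  have hr0 : 0 < r := by positivity
  have hNr : N * r ≤ 3 / 50 := by rw [hr]; linarith
  have hr2 : r ≤ 1 / 2 := by nlinarith
  have hcard : ∀ (v : M) (a m : ℕ), ∑ T ∈ powersetCard m (inNbrs w V a v), ∏ k ∈ T, y k ≤
      3 ^ (2 ^ a / (8 * N) + 1) / (1 / (16 * N * τ)) ^ m := by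
    intro v a m
    refine sum_powersetCard_prod_le hy _ _ _ (by positivity) ?_
    have h1 : ∑ k ∈ inNbrs w V a v, y k ≤ ∑ k ∈ inNbrs w V a v, 2 ^ a * τ * w k v := by
      refine sum_le_sum fun k hk => ?_
      have h2 : 1 / 2 ^ a ≤ w k v := (mem_filter.1 hk).2
      rw [div_le_iff₀ (by positivity)] at h2
      have := hyV k (mem_filter.1 hk).1
      nlinarith
    have h2 : ∑ k ∈ inNbrs w V a v, 2 ^ a * τ * w k v ≤ ∑ k, 2 ^ a * τ * w k v :=
      sum_le_sum_of_subset_of_nonneg (subset_univ _) fun k _ _ =>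
        mul_nonneg (by positivity) (hw k v)
    rw [← mul_sum univ] at h2
    have h3 : 2 ^ a * τ * ∑ k, w k v ≤ 2 ^ a * τ * 2 :=
      mul_le_mul_of_nonneg_left (hin v) (by positivity)
    have h4 : (2 ^ a : ℝ) / (8 * N) ≤ ((2 ^ a / (8 * N) + 1 : ℕ) : ℝ) := by
      rw [div_le_iff₀ (by positivity)]
      have := (Nat.lt_mul_div_succ (2 ^ a) (by omega : 0 < 8 * N)).le
      rw [mul_comm]
      exact_mod_cast this
    refine le_trans ?_ h4
    rw [div_mul_eq_mul_div, one_mul, div_le_div_iff₀ (by positivity) (by positivity)]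
    nlinarith [mul_le_mul_of_nonneg_right (h1.trans (h2.trans h3))
      (by positivity : (0 : ℝ) ≤ 8 * N)]
  have hinner : ∀ v ∈ V, ∀ a, ∑ T ∈ (powersetCard (2 ^ a / (8 * N) + 1)
      (inNbrs w V a v)).image (insert v), linkWeight y i T ≤
      (if i = v then r else 0) + (if i ∈ V then 24 * N * (w i v * y v) else 0) := by
    intro v hv a
    have hvn : v ∉ inNbrs w V a v := by
      intro h
      have h2 : 1 / 2 ^ a ≤ w v v := (mem_filter.1 h).2
      rw [hdiag v hv] at h2
      have : (0 : ℝ) < 1 / 2 ^ a := by positivity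
      linarith
    have hvT : ∀ {m : ℕ} {T}, T ∈ powersetCard m (inNbrs w V a v) → v ∉ T :=
      fun hT h => hvn ((mem_powersetCard.1 hT).1 h)
    rw [sum_image]
    · set m := 2 ^ a / (8 * N) with hm
      have hsecond : 0 ≤ if i ∈ V then 24 * N * (w i v * y v) else 0 := by
        split_ifs
        · have := hw i v
          have := hy v
          positivity
        · exact le_rfl
      by_cases hiv : i = v
      · subst hiv
        rw [sum_congr rfl fun T hT => linkWeight_insert_self (hvT hT), if_pos rfl]
        have h1 := hcard i a (m + 1)
        have h2 : (3 : ℝ) ^ (m + 1) / (1 / (16 * N * τ)) ^ (m + 1) = r ^ (m + 1) := by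
          rw [← div_pow, hr]
          congr 1
          field_simp
          norm_num
        rw [h2, pow_succ] at h1
        have h3 : r ^ m ≤ 1 := pow_le_one₀ hr0.le (by linarith)
        nlinarith
      · rw [sum_congr rfl fun T hT => linkWeight_insert_of_ne (hvT hT) hiv, ← mul_sum,
          if_neg hiv, zero_add]
        have h0 := sum_linkWeight_powersetCard_le hy (inNbrs w V a v) m i
        by_cases hi : i ∈ inNbrs w V a v
        · rw [if_pos hi] at h0
          obtain ⟨hiV, hwi⟩ := mem_filter.1 hi
          rw [if_pos hiV]
          have h1 := h0.trans (hcard v a m)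
          have h2 : (3 : ℝ) ^ (m + 1) / (1 / (16 * N * τ)) ^ m = 3 * r ^ m := by
            rw [pow_succ, mul_div_right_comm, ← div_pow, mul_comm, hr]
            congr 2
            field_simp
            norm_num
          rw [← hm, h2] at h1
          have h3 : (2 : ℝ) ^ a ≤ 8 * N * (m + 1) := by
            have := (Nat.lt_mul_div_succ (2 ^ a) (by omega : 0 < 8 * N)).le
            exact_mod_cast this
          have h4 : (m + 1) * r ^ m ≤ 1 := by
            have h5 : r ^ m ≤ (1 / 2) ^ m := pow_le_pow_left₀ hr0.le hr2 m
            have h6 : ((m + 1 : ℕ) : ℝ) ≤ 2 ^ m := by exact_mod_cast Nat.lt_two_pow_self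
            push_cast at h6
            calc (m + 1) * r ^ m ≤ 2 ^ m * (1 / 2) ^ m :=
                  mul_le_mul h6 h5 (by positivity) (by positivity)
              _ = 1 := by rw [← mul_pow]; norm_num
          have h7 : 3 * r ^ m ≤ 24 * N * w i v := by
            rw [div_le_iff₀ (by positivity)] at hwi
            have hwiv := hw i v
            have h8 : w i v * 2 ^ a * r ^ m ≤ w i v * (8 * N) := by
              calc w i v * 2 ^ a * r ^ m = w i v * (2 ^ a * r ^ m) := by ring
                _ ≤ w i v * (8 * N * (m + 1) * r ^ m) :=
                  mul_le_mul_of_nonneg_left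
                    (mul_le_mul_of_nonneg_right h3 (by positivity)) hwiv
                _ = w i v * (8 * N) * ((m + 1) * r ^ m) := by ring
                _ ≤ _ := mul_le_of_le_one_right (by positivity) h4
            have h9 : r ^ m ≤ w i v * 2 ^ a * r ^ m := le_mul_of_one_le_left (by positivity) hwi
            linarith
          calc _ ≤ y v * (24 * N * w i v) := mul_le_mul_of_nonneg_left (h1.trans h7) (hy v)
            _ = _ := by ring
        · rw [if_neg hi] at h0
          exact (mul_nonpos_of_nonneg_of_nonpos (hy v) h0).trans hsecond
    · intro T hT T' hT' h
      rw [← erase_insert (hvT hT), h, erase_insert (hvT hT')]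
  have hsum1 : ∑ v ∈ V, (if i = v then r else 0) ≤ r := by
    rw [sum_ite_eq]
    split_ifs <;> linarith
  have hsum2 : ∑ v ∈ V, (if i ∈ V then 24 * N * (w i v * y v) else 0) ≤ 24 * N * τ := by
    split_ifs with hi
    · rw [← mul_sum]
      refine mul_le_mul_of_nonneg_left (le_trans ?_ (hout i hi)) (by positivity)
      exact sum_le_sum_of_subset_of_nonneg (subset_univ _) fun k _ _ =>
        mul_nonneg (hw i k) (hy k)
    · rw [sum_const_zero]; positivity
  calc _ ≤ ∑ v ∈ V, ∑ a ∈ range N, ∑ T ∈ (powersetCard (2 ^ a / (8 * N) + 1)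
        (inNbrs w V a v)).image (insert v), linkWeight y i T :=
        (sum_biUnion_le_sum _ _ (linkWeight_nonneg hy i)).trans
          (sum_le_sum fun h _ => sum_biUnion_le_sum _ _ (linkWeight_nonneg hy i))
    _ ≤ ∑ v ∈ V, ∑ a ∈ range N,
        ((if i = v then r else 0) + (if i ∈ V then 24 * N * (w i v * y v) else 0)) :=
        sum_le_sum fun v hv => sum_le_sum fun a _ => hinner v hv a
    _ = N * (∑ v ∈ V, (if i = v then r else 0) +
          ∑ v ∈ V, (if i ∈ V then 24 * N * (w i v * y v) else 0)) := by
        simp only [sum_const, card_range, nsmul_eq_mul]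
        rw [← mul_sum, sum_add_distrib]
    _ ≤ N * (r + 24 * N * τ) := mul_le_mul_of_nonneg_left (add_le_add hsum1 hsum2) (by positivity)
    _ ≤ 1 / 4 := by nlinarith

theorem sum_out_le_of_avoids [Fintype M] {F : Finset M}
    (hdy : ∀ h k, w h k = 0 ∨ ∃ a < N, 1 / 2 ^ a ≤ w h k ∧ w h k ≤ 2 / 2 ^ a)
    (hF : ∀ T ∈ outStars w V N, ¬ T ⊆ F) (h : M) :
    ∑ k ∈ V ∩ F, w h k ≤ 160 * N ^ 2 := by
  refine (sum_le_of_card_threshold_le (c := 80 * N) (V ∩ F) (hdy h) fun a ha => ?_).trans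
    (by nlinarith)
  by_contra! hlt
  have hlt' : 80 * N * 2 ^ a + 1 ≤ ((V ∩ F).filter fun k => 1 / 2 ^ a ≤ w h k).card := by
    exact_mod_cast hlt
  obtain ⟨T, hT, hTc⟩ := exists_subset_card_eq hlt'
  refine hF T ?_ fun t ht => (mem_inter.1 (mem_filter.1 (hT ht)).1).2
  refine mem_biUnion.2 ⟨h, mem_univ h, mem_biUnion.2 ⟨a, mem_range.2 ha,
    mem_powersetCard.2 ⟨fun t ht => ?_, hTc⟩⟩⟩
  have := mem_filter.1 (hT ht)
  exact mem_filter.2 ⟨(mem_inter.1 this.1).1, this.2⟩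

theorem sum_in_le_of_avoids {F : Finset M} (hN : 1 ≤ N)
    (hdy : ∀ h k, w h k = 0 ∨ ∃ a < N, 1 / 2 ^ a ≤ w h k ∧ w h k ≤ 2 / 2 ^ a)
    (hF : ∀ T ∈ inStars w V N, ¬ T ⊆ F) {v : M} (hv : v ∈ V) (hvF : v ∈ F) :
    ∑ h ∈ V ∩ F, w h v ≤ 1 / 4 := by
  have hN' : (1 : ℝ) ≤ N := by exact_mod_cast hN
  refine (sum_le_of_card_threshold_le (c := 1 / (8 * N)) (V ∩ F) (fun h => hdy h v)
    fun a ha => ?_).trans (le_of_eq (by field_simp; norm_num))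
  have hle : ((V ∩ F).filter fun h => 1 / 2 ^ a ≤ w h v).card ≤ 2 ^ a / (8 * N) := by
    by_contra! hlt
    obtain ⟨T, hT, hTc⟩ := exists_subset_card_eq (Nat.succ_le_of_lt hlt)
    refine hF (insert v T) ?_ (insert_subset hvF fun t ht =>
      (mem_inter.1 (mem_filter.1 (hT ht)).1).2)
    refine mem_biUnion.2 ⟨v, hv, mem_biUnion.2 ⟨a, mem_range.2 ha, mem_image_of_mem _
      (mem_powersetCard.2 ⟨fun t ht => ?_, hTc⟩)⟩⟩
    have := mem_filter.1 (hT ht)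
    exact mem_filter.2 ⟨(mem_inter.1 this.1).1, this.2⟩
  calc _ ≤ ((2 ^ a / (8 * N) : ℕ) : ℝ) := by exact_mod_cast hle
    _ ≤ ((2 ^ a : ℕ) : ℝ) / ((8 * N : ℕ) : ℝ) := Nat.cast_div_le
    _ = _ := by push_cast; ring

end Stars

theorem card_inter_add_wSum_le {M : Type*} [Fintype M] [DecidableEq M] {w : M → M → ℝ}
    {z : M → ℝ} {θ δ ε ζ A : ℝ} {F V : Finset M} (hw : ∀ h k, 0 ≤ w h k) (hz : ∀ i, 0 ≤ z i)
    (hin : ∀ k, ∑ h, w h k ≤ 2)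
    (hload : ∀ h, z h + (∑ k, w k h * (1 - z h)) + (∑ k, w h k * z k) ≤ 1 + θ)
    (hV : ∀ v ∈ F, v ∉ V → ζ ≤ z v + ∑ k, w v k * z k)
    (hrow : ∀ h, ∑ k ∈ V ∩ F, w h k ≤ A)
    (hcol : ∀ v ∈ V, v ∈ F → ∑ h ∈ V ∩ F, w h v ≤ 1 / 4)
    (hA : 0 ≤ A) (hζ : 0 < ζ) (hζ1 : ζ ≤ 1) (hδ : δ ≤ 1 / 2) (hε : δ + θ ≤ ε)
    (hAε : (2 + A) * (4 * ε) ≤ ζ / 4) (hz1 : ∀ i, z i ≤ 1) (S : Finset M) :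
    ((S ∩ F).card : ℝ) + wSum w S S ≤ (2 - δ) * S.card := by
  by_contra! hlt
  set D := S \ (V ∩ F) with hD
  set U := S ∩ (V ∩ F) with hU
  have hn : (0 : ℝ) ≤ S.card := Nat.cast_nonneg _
  have hb : ((S \ F).card : ℝ) + (S ∩ F).card = S.card := by
    exact_mod_cast card_sdiff_add_card_inter S F
  have hb0 : (0 : ℝ) ≤ (S \ F).card := Nat.cast_nonneg _
  have hDU : (D.card : ℝ) + U.card = S.card := by
    exact_mod_cast card_sdiff_add_card_inter S (V ∩ F)
  have hcomm : wSum w S S = ∑ k ∈ S, ∑ h ∈ S, w h k := sum_comm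
  have hsub : ∀ (T : Finset M) (g : M → ℝ), (∀ k, 0 ≤ g k) → ∑ k ∈ T, g k ≤ ∑ k, g k :=
    fun T g hg => sum_le_sum_of_subset_of_nonneg (subset_univ _) fun k _ _ => hg k
  have hWI : wSum w S S ≤ ∑ k ∈ S, ∑ h, w h k := by
    rw [hcomm]
    exact sum_le_sum fun k _ => hsub S (fun h => w h k) fun h => hw h k
  have hsum : ∑ h ∈ S, (∑ k, w k h + ∑ k, w h k * z k) ≤ ∑ h ∈ S, (1 + θ + z h) := by
    refine sum_le_sum fun h _ => ?_
    have h1 := hload h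
    rw [← sum_mul] at h1
    nlinarith [hin h, hz h]
  have hsum' : ∑ h ∈ S, (z h + ∑ k ∈ S, w k h * (1 - z h) + ∑ k ∈ S, w h k * z k) ≤
      ∑ h ∈ S, (1 + θ) := by
    refine sum_le_sum fun h _ => le_trans ?_ (hload h)
    gcongr
    · exact fun k _ _ => mul_nonneg (hw k h) (by linarith [hz1 h])
    · exact subset_univ _
    · exact fun k _ _ => mul_nonneg (hw h k) (hz k)
    · exact subset_univ _
  have hW : ∑ h ∈ S, (z h + ∑ k ∈ S, w k h * (1 - z h) + ∑ k ∈ S, w h k * z k) =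
      ∑ h ∈ S, z h + wSum w S S := by
    have h1 : ∑ h ∈ S, ∑ k ∈ S, w h k * z k = ∑ h ∈ S, ∑ k ∈ S, w k h * z h := sum_comm
    rw [sum_add_distrib, sum_add_distrib, h1, add_assoc, ← sum_add_distrib, hcomm]
    congr 1
    refine sum_congr rfl fun h _ => ?_
    rw [← sum_add_distrib]
    exact sum_congr rfl fun k _ => by ring
  rw [hW, sum_const, nsmul_eq_mul] at hsum'
  rw [sum_add_distrib, sum_add_distrib, sum_const, nsmul_eq_mul] at hsum
  have hεn : S.card * (δ + θ) ≤ S.card * ε := mul_le_mul_of_nonneg_left hε hn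
  have hZb : ∑ h ∈ S, z h + (S \ F).card ≤ S.card * ε := by nlinarith
  have hZ0 : 0 ≤ ∑ h ∈ S, z h := sum_nonneg fun h _ => hz h
  have hO : ∑ h ∈ S, ∑ k, w h k * z k ≤ 2 * (S.card * ε) := by nlinarith
  have hcard : D.card ≤ (S \ F).card + ((S ∩ F) \ V).card := by
    refine (card_le_card fun i hi => ?_).trans (card_union_le _ _)
    simp only [hD, mem_sdiff, mem_inter, mem_union] at hi ⊢
    tauto
  have hmarkov : ((S ∩ F) \ V).card * ζ ≤ 3 * (S.card * ε) := by
    have h1 : ∑ i ∈ (S ∩ F) \ V, ζ ≤ ∑ i ∈ (S ∩ F) \ V, (z i + ∑ k, w i k * z k) :=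
      sum_le_sum fun i hi => by
        simp only [mem_sdiff, mem_inter] at hi
        exact hV i hi.1.2 hi.2
    have h2 : ∑ i ∈ (S ∩ F) \ V, (z i + ∑ k, w i k * z k) ≤
        ∑ i ∈ S, (z i + ∑ k, w i k * z k) :=
      sum_le_sum_of_subset_of_nonneg (sdiff_subset.trans inter_subset_left) fun i _ _ =>
        add_nonneg (hz i) (sum_nonneg fun k _ => mul_nonneg (hw i k) (hz k))
    rw [sum_const, nsmul_eq_mul] at h1
    rw [sum_add_distrib (s := S)] at h2
    linarith
  have hDζ : D.card * ζ ≤ 4 * (S.card * ε) := by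
    have h1 : (D.card : ℝ) ≤ (S \ F).card + ((S ∩ F) \ V).card := by exact_mod_cast hcard
    nlinarith
  have hDn : (2 + A) * D.card ≤ S.card / 4 := by
    refine le_of_mul_le_mul_right ?_ hζ
    nlinarith
  have hcols : ∑ k ∈ D, ∑ h ∈ S, w h k ≤ D.card * 2 := by
    rw [← nsmul_eq_mul]
    exact sum_le_card_nsmul _ _ _ fun k _ =>
      (hsub S (fun h => w h k) fun h => hw h k).trans (hin k)
  have hrows : ∑ h ∈ D, ∑ k ∈ U, w h k ≤ D.card * A := by
    rw [← nsmul_eq_mul]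
    exact sum_le_card_nsmul _ _ _ fun h _ =>
      (sum_le_sum_of_subset_of_nonneg inter_subset_right fun k _ _ => hw h k).trans (hrow h)
  have hblock : ∑ k ∈ U, ∑ h ∈ U, w h k ≤ U.card * (1 / 4) := by
    rw [← nsmul_eq_mul]
    refine sum_le_card_nsmul _ _ _ fun k hk => ?_
    have hk' := mem_inter.1 (mem_inter.1 hk).2
    exact (sum_le_sum_of_subset_of_nonneg inter_subset_right fun h _ _ => hw h k).trans
      (hcol k hk'.1 hk'.2)
  have hsplit : wSum w S S = ∑ k ∈ D, ∑ h ∈ S, w h k +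
      (∑ h ∈ D, ∑ k ∈ U, w h k + ∑ k ∈ U, ∑ h ∈ U, w h k) := by
    have h1 : ∀ g : M → ℝ, ∑ i ∈ D, g i + ∑ i ∈ U, g i = ∑ i ∈ S, g i := fun g => by
      rw [add_comm]
      exact sum_inter_add_sum_sdiff S (V ∩ F) g
    rw [sum_comm (s := D) (t := U), ← sum_add_distrib, hcomm, ← h1]
    congr 1
    exact sum_congr rfl fun k _ => (h1 _).symm
  nlinarith

theorem exists_dyadic_bound {x q : ℝ} {N : ℕ} (hq : 0 < q) (hqN : q ≤ 2 ^ N) (hx : 1 / q ≤ x)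
    (hx2 : x ≤ 2) : ∃ a < N + 1, 1 / 2 ^ a ≤ x ∧ x ≤ 2 / 2 ^ a := by
  have hN : (1 : ℝ) / 2 ^ N ≤ x := (one_div_le_one_div_of_le hq hqN).trans hx
  have hex : ∃ a : ℕ, (1 : ℝ) / 2 ^ a ≤ x := ⟨N, hN⟩
  refine ⟨Nat.find hex, Nat.lt_succ_of_le (Nat.find_le hN), Nat.find_spec hex, ?_⟩
  rcases Nat.eq_zero_or_pos (Nat.find hex) with h0 | h0
  · rw [h0]
    simpa using hx2
  · have h1 := Nat.find_min hex (Nat.sub_lt h0 one_pos)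
    obtain ⟨b, hb⟩ := Nat.exists_eq_succ_of_ne_zero h0.ne'
    rw [hb] at h1 ⊢
    simp only [Nat.succ_eq_add_one, Nat.add_sub_cancel, not_le] at h1
    refine h1.le.trans (le_of_eq ?_)
    rw [pow_succ]
    field_simp

theorem exists_assignment_sparse_image {M JH : Type*} [Fintype M] [DecidableEq M] [Fintype JH]
    {Mach : JH → Finset M} {w : M → M → ℝ} {z : M → ℝ} {ζ : ℝ} {N : ℕ} {V : Finset M}
    (hcan : IsCanonical Mach w z) (hN : 1 ≤ N) (hin : ∀ k, ∑ h, w h k ≤ 2)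
    (hout : ∀ h, ∑ k, w h k * z k ≤ 2)
    (hdy : ∀ h k, w h k = 0 ∨ ∃ a < N, 1 / 2 ^ a ≤ w h k ∧ w h k ≤ 2 / 2 ^ a)
    (hMach : ∀ j, 1 / 6 ≤ ∑ i ∈ Mach j, z i) (hζ : 0 < ζ) (hNζ : 9600 * N ^ 2 * ζ ≤ 1)
    (hV : ∀ v ∈ V, 0 < z v ∧ z v ≤ ζ ∧ ∑ k, w v k * z k ≤ ζ) :
    ∃ f : JH → M, IsValid Mach f ∧
      (∀ h, ∑ k ∈ V ∩ univ.image f, w h k ≤ 160 * N ^ 2) ∧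
      ∀ v ∈ V, v ∈ univ.image f → ∑ h ∈ V ∩ univ.image f, w h v ≤ 1 / 4 := by
  obtain ⟨hdisj, hw, -, hdiag, hz, -⟩ := hcan
  have hy : ∀ i, 0 ≤ 12 * z i := fun i => by linarith [(hz i).1]
  have hy12 : ∀ h, ∑ k, w h k * (12 * z k) = 12 * ∑ k, w h k * z k := fun h => by
    rw [mul_sum]
    exact sum_congr rfl fun k _ => by ring
  obtain ⟨f, hf, havoid⟩ := exists_assignment_avoiding (Mach := Mach)
    (p := fun j i => z i / ∑ k ∈ Mach j, z k) (y := fun i => 12 * z i)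
    (𝒯 := outStars w V N ∪ inStars w V N) hdisj
    (fun j i _ => div_nonneg (hz i).1 (sum_nonneg fun k _ => (hz k).1))
    (fun j => by rw [← sum_div]; exact div_self (by linarith [hMach j])) hy
    (fun j i _ => by
      have := hMach j
      rw [← mul_div_assoc, div_le_iff₀ (by linarith)]
      nlinarith [(hz i).1])
    (fun h0 => by
      rcases mem_union.1 h0 with h0 | h0
      · simp [outStars, mem_powersetCard] at h0
      · simp [inStars] at h0)
    (fun i => by
      have h1 := sum_linkWeight_outStars_le (V := V) hN hw hy hin
        (fun h => by rw [hy12]; linarith [hout h]) i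
      have h2 := sum_linkWeight_inStars_le (V := V) (τ := 12 * ζ) hN hw hy hin (by positivity)
        (by linarith) (fun h hh => by rw [hy12]; linarith [(hV h hh).2.2])
        (fun h hh => by linarith [(hV h hh).2.1]) (fun h hh => hdiag h (hV h hh).1) i
      have h3 := sum_union_inter (s₁ := outStars w V N) (s₂ := inStars w V N)
        (f := linkWeight (fun i => 12 * z i) i)
      have h4 : 0 ≤ ∑ T ∈ outStars w V N ∩ inStars w V N, linkWeight (fun i => 12 * z i) i T :=
        sum_nonneg fun T _ => linkWeight_nonneg hy i T
      refine le_of_eq_of_le (sum_congr ?_ fun T _ => ?_)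
        (by linarith :
          ∑ T ∈ outStars w V N ∪ inStars w V N, linkWeight (fun i => 12 * z i) i T ≤ 1 / 2)
      · rfl
      · unfold linkWeight
        congr)
  have havoid' : ∀ T ∈ outStars w V N ∪ inStars w V N, ¬ T ⊆ univ.image f := by
    intro T hT hsub
    exact havoid T hT (by convert hsub)
  exact ⟨f, hf,
    sum_out_le_of_avoids hdy fun T hT => havoid' T (mem_union_left _ hT),
    fun v hv hvF => sum_in_le_of_avoids hN hdy
      (fun T hT => havoid' T (mem_union_right _ hT)) hv hvF⟩

theorem isGood_of_card_inter_add_wSum_le {M JH : Type*} [Fintype M] [DecidableEq M] [Fintype JH]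
    {w : M → M → ℝ} {δ : ℝ} {f : JH → M} (hw : ∀ h k, 0 ≤ w h k)
    (h : ∀ S : Finset M, ((S ∩ univ.image f).card : ℝ) + wSum w S S ≤ (2 - δ) * S.card) :
    IsGood w δ f := by
  obtain ⟨s, hs, hs'⟩ := exists_split_of_wSum_le w hw
    (fun i => 2 - δ - if i ∈ univ.image f then (1 : ℝ) else 0) fun S => by
      rw [sum_sub_distrib, sum_const, nsmul_eq_mul, ← sum_filter, sum_const, nsmul_eq_mul,
        mul_one, filter_mem_eq_inter]
      linarith [h S]
  exact ⟨s, hs, fun i => by linarith [hs' i]⟩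
/-- **Solving canonical instances with small p and q.** There is a constant `C` large enough
so that for every `q₀ ≥ 100` and every `θ ∈ [0, (log q₀)⁻⁵/(4C))`, every
`(q₀, q₀, θ)`-canonical instance admits a `((log q₀)⁻⁵/C - 4θ)`-good assignment. -/
theorem small_q_good_assignment :
    ∃ C : ℝ, 0 < C ∧
      ∀ (M JH : Type) [Fintype M] [DecidableEq M] [Fintype JH]
        (Mach : JH → Finset M) (w : M → M → ℝ) (z : M → ℝ) (q0 θ : ℝ),
        100 ≤ q0 →
        0 ≤ θ → θ < ((Real.log q0) ^ (5 : ℕ))⁻¹ / (4 * C) →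
        IsPQCanonical Mach w z q0 q0 θ →
        ∃ f : JH → M, IsValid Mach f ∧
          IsGood w (((Real.log q0) ^ (5 : ℕ))⁻¹ / C - 4 * θ) f := by
  refine ⟨10 ^ 10, by norm_num, ?_⟩
  intro M JH _ _ _ Mach w z q0 θ hq0 hθ0 hθ hcan
  obtain ⟨hcan', -, -, -, -, -, hwq, hMach, hload⟩ := hcan
  have hcan'' := hcan'
  obtain ⟨-, hw, -, -, hz, hzero⟩ := hcan''
  set L := Real.log q0 with hL
  have hq0' : 0 < q0 := by linarith
  have hL4 : 4 ≤ L := by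
    rw [hL, Real.le_log_iff_exp_le hq0']
    have h1 : Real.exp 4 = Real.exp 1 ^ 4 := by rw [← Real.exp_nat_mul]; norm_num
    rw [h1]
    calc Real.exp 1 ^ 4 ≤ 3 ^ 4 := by gcongr; linarith [Real.exp_one_lt_d9]
      _ ≤ q0 := by linarith
  set ε : ℝ := (L ^ 5)⁻¹ / 10 ^ 10 with hεdef
  have hε0 : 0 < ε := by positivity
  have hεL : ε * L ^ 5 = 1 / 10 ^ 10 := by rw [hεdef]; field_simp
  have hε1 : ε ≤ 1 / 10 ^ 10 := by
    have : 1 ≤ L ^ 5 := one_le_pow₀ (by linarith)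
    nlinarith
  have hθε : 4 * θ < ε := by
    have h1 : (L ^ 5)⁻¹ / (4 * 10 ^ 10) = ε / 4 := by rw [hεdef]; ring
    rw [h1] at hθ
    linarith
  obtain ⟨n, hn2, hn3⟩ : ∃ n : ℕ, 2 * L ≤ n ∧ n + 1 ≤ 3 * L := by
    refine ⟨⌈2 * L⌉₊, Nat.le_ceil _, ?_⟩
    linarith [Nat.ceil_lt_add_one (a := 2 * L) (by linarith)]
  have hqn : q0 ≤ 2 ^ n := by
    rw [← Real.log_le_log_iff hq0' (by positivity), Real.log_pow]
    nlinarith [Real.log_two_gt_d9]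
  have hin : ∀ k, ∑ h, w h k ≤ 2 := by
    intro k
    have h1 := hload k
    rw [← sum_mul] at h1
    have h2 : 0 ≤ ∑ i, w k i * z i := sum_nonneg fun i _ => mul_nonneg (hw k i) (hz i).1
    have h3 : 0 ≤ ∑ h, w h k := sum_nonneg fun h _ => hw h k
    have h4 := (hz k).2
    nlinarith [(hz k).1]
  have hout : ∀ h, ∑ k, w h k * z k ≤ 2 := by
    intro h
    have h1 := hload h
    have h2 : 0 ≤ ∑ k, w k h * (1 - z h) :=
      sum_nonneg fun k _ => mul_nonneg (hw k h) (by linarith [(hz h).2])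
    linarith [(hz h).1]
  have hdy : ∀ h k, w h k = 0 ∨ ∃ a < n + 1, 1 / 2 ^ a ≤ w h k ∧ w h k ≤ 2 / 2 ^ a := by
    intro h k
    refine (hwq h k).imp_right fun h1 => exists_dyadic_bound hq0' hqn h1 ?_
    exact (single_le_sum (f := fun h => w h k) (fun h _ => hw h k) (mem_univ h)).trans (hin k)
  have hn0 : (0 : ℝ) < (n : ℝ) + 1 := by positivity
  set ζ : ℝ := 1 / (10 ^ 4 * ((n : ℝ) + 1) ^ 2) with hζdef
  have hζ : 0 < ζ := by positivity
  have hnζ : ((n : ℝ) + 1) ^ 2 * ζ = 1 / 10 ^ 4 := by rw [hζdef]; field_simp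
  have hone : 1 ≤ ((n : ℝ) + 1) ^ 2 := one_le_pow₀ (by linarith [Nat.cast_nonneg (α := ℝ) n])
  set V : Finset M := univ.filter fun v => 0 < z v ∧ z v ≤ ζ ∧ ∑ k, w v k * z k ≤ ζ with hV
  obtain ⟨f, hf, hrow, hcol⟩ := exists_assignment_sparse_image (V := V) hcan'
    (Nat.le_add_left 1 n) hin hout hdy (fun j => by linarith [hMach j]) hζ
    (by push_cast; linarith) fun v hv => (mem_filter.1 hv).2
  refine ⟨f, hf, isGood_of_card_inter_add_wSum_le hw ?_⟩
  refine card_inter_add_wSum_le (θ := θ) (ε := ε) (ζ := ζ) (V := V) hw (fun i => (hz i).1) hin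
    hload ?_ hrow hcol (by positivity) hζ (by nlinarith) (by linarith) (by linarith) ?_
    fun i => by linarith [(hz i).2]
  · intro v hv hvV
    obtain ⟨j, -, rfl⟩ := mem_image.1 hv
    have h0 : 0 < z (f j) :=
      lt_of_le_of_ne (hz _).1 fun h0 => (hzero _).1 h0.symm j (hf j)
    have h1 : 0 ≤ ∑ k, w (f j) k * z k := sum_nonneg fun k _ => mul_nonneg (hw _ k) (hz k).1
    by_contra! hlt
    exact hvV (mem_filter.2 ⟨mem_univ _, h0, by linarith, by linarith⟩)
  · push_cast
    have h1 : ((n : ℝ) + 1) ^ 4 ≤ (3 * L) ^ 4 := by gcongr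
    have h2 : ε * L ^ 4 * 4 ≤ 1 / 10 ^ 10 := by
      rw [← hεL]
      nlinarith [mul_nonneg hε0.le (pow_nonneg (by linarith : 0 ≤ L) 4)]
    have h3 : 162 * ((n : ℝ) + 1) ^ 2 * (4 * ε) ≤ ζ / 4 := by
      refine le_of_mul_le_mul_left ?_ (by positivity : 0 < ((n : ℝ) + 1) ^ 2)
      nlinarith
    refine le_trans ?_ h3
    gcongr
    linarith
end
end
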